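/- Let φ : 𝒞 → [0,∞] be additive, positively homogeneous, dilation invariant, and increasing-monotone, i.e. such that ∫_0^t μ(s) ds ≤ ∫_0^t ν(s) ds for all t > 0 implies φ(μ) ≤ φ(ν). Let p, q ∈ (1,∞) with 1/p + 1/q = 1, and let ρ, μ, ν ∈ 𝒞 satisfy ∫_0^t ρ(s) ds ≤ ∫_0^t μ(s)ν(s) ds for all t > 0, with φ(μ^p) < ∞ and φ(ν^q) < ∞. Then φ(ρ) ≤ φ(μ^p)^{1/p} · φ(ν^q)^{1/q}. (This is the Hölder inequality, with constant 1, for singular traces τ_ω(a) = φ(μ_a) generated by a monotone dilation-invariant functional φ: by Weyl's inequality the functions ρ = μ_{ab}, μ = μ_a, ν = μ_b satisfy the displayed integral hypothesis.) -/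

import Mathlib

open Filter MeasureTheory

/-- Membership in the cone `𝒞` of non-increasing, right-continuous functions
`[0,∞) → [0,∞)` (modelled as functions on `ℝ`, with the conditions imposed on `[0,∞)`). -/
def InCone (μ : ℝ → ℝ) : Prop :=
  (∀ x, 0 ≤ μ x) ∧ AntitoneOn μ (Set.Ici 0) ∧
    ∀ x : ℝ, 0 ≤ x → ContinuousWithinAt μ (Set.Ici x) x

namespace InCone

variable {μ ν : ℝ → ℝ}

theorem integrableOn (hμ : InCone μ) (t : ℝ) : IntegrableOn μ (Set.Ioc 0 t) :=
  ((hμ.2.1.mono Set.Icc_subset_Ici_self).integrableOn_isCompact isCompact_Icc).mono_set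
    Set.Ioc_subset_Icc_self

theorem add (hμ : InCone μ) (hν : InCone ν) : InCone fun t => μ t + ν t :=
  ⟨fun x => add_nonneg (hμ.1 x) (hν.1 x), hμ.2.1.add hν.2.1,
    fun x hx => (hμ.2.2 x hx).add (hν.2.2 x hx)⟩

theorem mul (hμ : InCone μ) (hν : InCone ν) : InCone fun t => μ t * ν t :=
  ⟨fun x => mul_nonneg (hμ.1 x) (hν.1 x),
    fun x hx y hy hxy =>
      mul_le_mul (hμ.2.1 hx hy hxy) (hν.2.1 hx hy hxy) (hν.1 y) (hμ.1 x),
    fun x hx => (hμ.2.2 x hx).mul (hν.2.2 x hx)⟩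

theorem const_mul {c : ℝ} (hc : 0 ≤ c) (hμ : InCone μ) : InCone fun t => c * μ t :=
  ⟨fun x => mul_nonneg hc (hμ.1 x),
    fun _ hx _ hy hxy => mul_le_mul_of_nonneg_left (hμ.2.1 hx hy hxy) hc,
    fun x hx => (hμ.2.2 x hx).const_mul c⟩

theorem rpow {r : ℝ} (hr : 0 ≤ r) (hμ : InCone μ) : InCone fun t => μ t ^ r :=
  ⟨fun x => Real.rpow_nonneg (hμ.1 x) r,
    fun _ hx y hy hxy => Real.rpow_le_rpow (hμ.1 y) (hμ.2.1 hx hy hxy) hr,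
    fun x hx => (hμ.2.2 x hx).rpow_const (Or.inr hr)⟩

end InCone

/-- Young's inequality with weights `α, β`, normalised so that it is sharp when
`x ^ p = α` and `y ^ q = β`. -/
theorem mul_le_weighted_rpow_add_rpow {p q x y α β : ℝ} (hpq : p.HolderConjugate q)
    (hx : 0 ≤ x) (hy : 0 ≤ y) (hα : 0 < α) (hβ : 0 < β) :
    x * y ≤ α ^ (1 / p) * β ^ (1 / q) / (p * α) * x ^ p +
      α ^ (1 / p) * β ^ (1 / q) / (q * β) * y ^ q := by
  have hA : 0 < α ^ (1 / p) := Real.rpow_pos_of_pos hα _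
  have hB : 0 < β ^ (1 / q) := Real.rpow_pos_of_pos hβ _
  have hp := hpq.pos
  have hq := hpq.symm.pos
  have young := Real.young_inequality_of_nonneg (div_nonneg hx hA.le) (div_nonneg hy hB.le) hpq
  rw [Real.div_rpow hx hA.le, Real.div_rpow hy hB.le, ← Real.rpow_mul hα.le,
    ← Real.rpow_mul hβ.le, one_div_mul_cancel hp.ne', one_div_mul_cancel hq.ne',
    Real.rpow_one, Real.rpow_one] at young
  calc x * y = α ^ (1 / p) * β ^ (1 / q) * (x / α ^ (1 / p) * (y / β ^ (1 / q))) := by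
        field_simp
    _ ≤ α ^ (1 / p) * β ^ (1 / q) * (x ^ p / α / p + y ^ q / β / q) := by gcongr
    _ = _ := by field_simp

/-- H\"older inequality, with constant `1`, for singular traces generated by an
increasing-monotone dilation-invariant functional `φ` on the cone `𝒞`: if
`∫₀ᵗ ρ ≤ ∫₀ᵗ μν` for all `t > 0` (as holds for `ρ = μ_{ab}`, `μ = μ_a`, `ν = μ_b` by
Weyl's inequality) and `p, q ∈ (1,∞)` are conjugate exponents, then
`φ(ρ) ≤ φ(μ^p)^{1/p}·φ(ν^q)^{1/q}`. -/
theorem stmt17 (φ : (ℝ → ℝ) → ENNReal)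
    (hadd : ∀ μ ν, InCone μ → InCone ν → φ (fun t => μ t + ν t) = φ μ + φ ν)
    (hhom : ∀ (c : ℝ), 0 < c → ∀ μ, InCone μ →
      φ (fun t => c * μ t) = ENNReal.ofReal c * φ μ)
    (hmono : ∀ μ ν, InCone μ → InCone ν →
      (∀ t : ℝ, 0 < t → (∫ s in Set.Ioc (0:ℝ) t, μ s) ≤ ∫ s in Set.Ioc (0:ℝ) t, ν s) →
      φ μ ≤ φ ν)
    (hdil : ∀ (a : ℝ), 0 < a → ∀ μ, InCone μ →
      ENNReal.ofReal a * φ (fun t => μ (a * t)) = φ μ)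
    (p q : ℝ) (hp : 1 < p) (hq : 1 < q) (hpq : 1 / p + 1 / q = 1)
    (ρ μ ν : ℝ → ℝ) (hρ : InCone ρ) (hμ : InCone μ) (hν : InCone ν)
    (hweyl : ∀ t : ℝ, 0 < t →
      (∫ s in Set.Ioc (0:ℝ) t, ρ s) ≤ ∫ s in Set.Ioc (0:ℝ) t, μ s * ν s)
    (hμp : φ (fun t => μ t ^ p) < ⊤) (hνq : φ (fun t => ν t ^ q) < ⊤) :
    φ ρ ≤ (φ (fun t => μ t ^ p)) ^ (1 / p) * (φ (fun t => ν t ^ q)) ^ (1 / q) := by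
  have hc : p.HolderConjugate q := by
    rw [Real.holderConjugate_iff]
    exact ⟨hp, by simpa only [one_div] using hpq⟩
  have hp0 := hc.pos
  have hq0 := hc.symm.pos
  have hμp' := hμ.rpow hp0.le
  have hνq' := hν.rpow hq0.le
  obtain ⟨a, ha⟩ : ∃ a, a = (φ fun t => μ t ^ p).toReal := ⟨_, rfl⟩
  obtain ⟨b, hb⟩ : ∃ b, b = (φ fun t => ν t ^ q).toReal := ⟨_, rfl⟩
  have hφa : (φ fun t => μ t ^ p) = ENNReal.ofReal a := by rw [ha, ENNReal.ofReal_toReal hμp.ne]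
  have hφb : (φ fun t => ν t ^ q) = ENNReal.ofReal b := by rw [hb, ENNReal.ofReal_toReal hνq.ne]
  have ha0 : 0 ≤ a := ha ▸ ENNReal.toReal_nonneg
  have hb0 : 0 ≤ b := hb ▸ ENNReal.toReal_nonneg
  have bound : ∀ ε : ℝ, 0 < ε →
      φ ρ ≤ ENNReal.ofReal ((a + ε) ^ (1 / p) * (b + ε) ^ (1 / q)) := by
    intro ε hε
    have hα : 0 < a + ε := by positivity
    have hβ : 0 < b + ε := by positivity
    obtain ⟨K, hK⟩ : ∃ K, K = (a + ε) ^ (1 / p) * (b + ε) ^ (1 / q) := ⟨_, rfl⟩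
    have hK0 : 0 < K := hK ▸ by positivity
    have hc₁ : 0 < K / (p * (a + ε)) := by positivity
    have hc₂ : 0 < K / (q * (b + ε)) := by positivity
    have h₁ := hμp'.const_mul hc₁.le
    have h₂ := hνq'.const_mul hc₂.le
    have key := hmono ρ _ hρ (h₁.add h₂) fun t ht => (hweyl t ht).trans <|
      setIntegral_mono ((hμ.mul hν).integrableOn t) ((h₁.add h₂).integrableOn t) fun s => by
        have := mul_le_weighted_rpow_add_rpow hc (hμ.1 s) (hν.1 s) hα hβ
        rwa [← hK] at this
    rw [hadd _ _ h₁ h₂, hhom _ hc₁ _ hμp', hhom _ hc₂ _ hνq', hφa, hφb,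
      ← ENNReal.ofReal_mul hc₁.le, ← ENNReal.ofReal_mul hc₂.le,
      ← ENNReal.ofReal_add (by positivity) (by positivity)] at key
    rw [← hK]
    refine key.trans (ENNReal.ofReal_le_ofReal ?_)
    calc K / (p * (a + ε)) * a + K / (q * (b + ε)) * b
        ≤ K / (p * (a + ε)) * (a + ε) + K / (q * (b + ε)) * (b + ε) := by
          gcongr <;> linarith
      _ = K * (1 / p + 1 / q) := by field_simp
      _ = K := by rw [hpq, mul_one]
  have hp1 : 0 ≤ 1 / p := by positivity
  have hq1 : 0 ≤ 1 / q := by positivity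
  rw [hφa, hφb, ENNReal.ofReal_rpow_of_nonneg ha0 hp1, ENNReal.ofReal_rpow_of_nonneg hb0 hq1,
    ← ENNReal.ofReal_mul (by positivity)]
  have hcont : Continuous fun ε : ℝ =>
      ENNReal.ofReal ((a + ε) ^ (1 / p) * (b + ε) ^ (1 / q)) :=
    ENNReal.continuous_ofReal.comp <|
      ((continuous_const.add continuous_id).rpow_const fun _ => Or.inr hp1).mul
        ((continuous_const.add continuous_id).rpow_const fun _ => Or.inr hq1)
  have hlim := (hcont.tendsto 0).mono_left (nhdsWithin_le_nhds (s := Set.Ioi 0))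
  simp only [add_zero] at hlim
  exact ge_of_tendsto hlim (eventually_nhdsWithin_of_forall bound)
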